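/- arXiv:2603.16324 — 2 statements merged into one kernel-verified Lean document; each statement's English description precedes it below -/
import Mathlib

section
/- Under the gap condition, the real vector space of smooth Γ-periodic functions f with Δf = λ₁·f is two-dimensional, spanned by u₁ and u₂; the functions u₁ and u₂ are orthonormal in L²(F, Lebesgue measure); and every smooth Γ-periodic eigenfunction of Δ with a positive eigenvalue λ satisfies λ ≥ λ₁. -/
open MeasureTheory Real Filter Topology Asymptotics
open scoped InnerProductSpace

noncomputable section

/-- Euclidean space `ℝⁿ`. -/
abbrev E (n : ℕ) := EuclideanSpace ℝ (Fin n)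

/-- The vector `A·t ∈ ℝⁿ`. -/
def matVec {n : ℕ} (A : Matrix (Fin n) (Fin n) ℝ) (t : Fin n → ℝ) : E n :=
  (WithLp.equiv 2 (Fin n → ℝ)).symm (A.mulVec t)

/-- The lattice `Γ = A·ℤⁿ`. -/
def lattice {n : ℕ} (A : Matrix (Fin n) (Fin n) ℝ) : Set (E n) :=
  {x | ∃ m : Fin n → ℤ, x = matVec A fun i => (m i : ℝ)}

/-- The dual lattice `Γ* = {w : ⟨w,x⟩ ∈ ℤ for all x ∈ Γ}`. -/
def dualLattice {n : ℕ} (Γ : Set (E n)) : Set (E n) :=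
  {w | ∀ x ∈ Γ, ∃ k : ℤ, ⟪w, x⟫_ℝ = (k : ℝ)}

/-- `f` is `Γ`-periodic. -/
def IsPeriodic {n : ℕ} (Γ : Set (E n)) (f : E n → ℝ) : Prop :=
  ∀ x : E n, ∀ γ ∈ Γ, f (x + γ) = f x

/-- The fundamental domain `F = A·[0,1)ⁿ`. -/
def fundDomain {n : ℕ} (A : Matrix (Fin n) (Fin n) ℝ) : Set (E n) :=
  {x | ∃ t : Fin n → ℝ, (∀ i, t i ∈ Set.Ico (0:ℝ) 1) ∧ x = matVec A t}

/-- Geometer's (nonnegative) Laplacian: `Δ f = -∑ᵢ ∂²f/∂xᵢ²`. -/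
def lap {n : ℕ} (f : E n → ℝ) (x : E n) : ℝ :=
  -∑ i : Fin n, iteratedFDeriv ℝ 2 f x ![EuclideanSpace.single i 1, EuclideanSpace.single i 1]

/-- The gap condition: `w ∈ Γ* \ {0}` and `|w| < |v|` for every `v ∈ Γ* \ {0, w, -w}`. -/
def GapCondition {n : ℕ} (Γ : Set (E n)) (w : E n) : Prop :=
  w ∈ dualLattice Γ ∧ w ≠ 0 ∧
    ∀ v ∈ dualLattice Γ, v ≠ 0 → v ≠ w → v ≠ -w → ‖w‖ < ‖v‖

/-- `u₁(x) = √2·D^{-1/2}·sin(2π⟨w,x⟩)` where `D = |det A|`. -/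
def uSin {n : ℕ} (A : Matrix (Fin n) (Fin n) ℝ) (w : E n) : E n → ℝ :=
  fun x => Real.sqrt 2 / Real.sqrt |A.det| * Real.sin (2 * π * ⟪w, x⟫_ℝ)

/-- `u₂(x) = √2·D^{-1/2}·cos(2π⟨w,x⟩)` where `D = |det A|`. -/
def uCos {n : ℕ} (A : Matrix (Fin n) (Fin n) ℝ) (w : E n) : E n → ℝ :=
  fun x => Real.sqrt 2 / Real.sqrt |A.det| * Real.cos (2 * π * ⟪w, x⟫_ℝ)

/-- The linear isomorphism `t ↦ A·t`. -/
def matVecEquiv {n : ℕ} (A : Matrix (Fin n) (Fin n) ℝ) (hA : IsUnit A.det) :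
    (Fin n → ℝ) ≃ₗ[ℝ] E n :=
  (Matrix.toLinearEquiv (Pi.basisFun ℝ (Fin n)) A hA).trans (WithLp.linearEquiv 2 ℝ _).symm

theorem matVecEquiv_apply {n : ℕ} (A : Matrix (Fin n) (Fin n) ℝ) (hA : IsUnit A.det)
    (t : Fin n → ℝ) : matVecEquiv A hA t = matVec A t := by
  simp [matVecEquiv, matVec, Matrix.toLin_eq_toLin']

/-- The columns of `A`, as a basis of `ℝⁿ`. -/
def columnBasis {n : ℕ} (A : Matrix (Fin n) (Fin n) ℝ) (hA : IsUnit A.det) :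
    Module.Basis (Fin n) ℝ (E n) :=
  Module.Basis.ofEquivFun (matVecEquiv A hA).symm

theorem matVec_columnBasis_repr {n : ℕ} (A : Matrix (Fin n) (Fin n) ℝ) (hA : IsUnit A.det)
    (x : E n) : matVec A ((columnBasis A hA).repr x) = x := by
  rw [← matVecEquiv_apply A hA]
  simp [columnBasis, Module.Basis.ofEquivFun]

theorem columnBasis_repr_matVec {n : ℕ} (A : Matrix (Fin n) (Fin n) ℝ) (hA : IsUnit A.det)
    (t : Fin n → ℝ) (i : Fin n) : (columnBasis A hA).repr (matVec A t) i = t i := by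
  rw [← matVecEquiv_apply A hA]
  simp [columnBasis]

theorem lattice_eq_span {n : ℕ} (A : Matrix (Fin n) (Fin n) ℝ) (hA : IsUnit A.det) :
    lattice A = Submodule.span ℤ (Set.range (columnBasis A hA)) := by
  ext x
  simp only [_root_.lattice, Set.mem_ofPred_eq, SetLike.mem_coe, Module.Basis.mem_span_iff_repr_mem]
  constructor
  · rintro ⟨m, rfl⟩ i
    exact ⟨m i, by simp [columnBasis_repr_matVec]⟩
  · intro h
    choose m hm using h
    refine ⟨m, ?_⟩
    conv_lhs => rw [← matVec_columnBasis_repr A hA x]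
    congr 1
    ext i
    simpa using (hm i).symm

theorem fundDomain_eq_fundamentalDomain {n : ℕ} (A : Matrix (Fin n) (Fin n) ℝ)
    (hA : IsUnit A.det) : fundDomain A = ZSpan.fundamentalDomain (columnBasis A hA) := by
  ext x
  rw [ZSpan.mem_fundamentalDomain]
  constructor
  · rintro ⟨t, ht, rfl⟩ i
    rw [columnBasis_repr_matVec]
    exact ht i
  · intro h
    exact ⟨_, h, (matVec_columnBasis_repr A hA x).symm⟩

theorem isBounded_fundDomain {n : ℕ} (A : Matrix (Fin n) (Fin n) ℝ) (hA : IsUnit A.det) :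
    Bornology.IsBounded (fundDomain A) := by
  rw [fundDomain_eq_fundamentalDomain A hA]
  exact ZSpan.fundamentalDomain_isBounded _

theorem volume_fundDomain {n : ℕ} (A : Matrix (Fin n) (Fin n) ℝ) :
    volume (fundDomain A) = ENNReal.ofReal |A.det| := by
  have h : fundDomain A = WithLp.toLp 2 ''
      (Matrix.toLin' A '' (Set.univ.pi fun _ => Set.Ico (0 : ℝ) 1)) := by
    ext x
    simp only [fundDomain, Set.image_image, Set.mem_image, Set.mem_ofPred_eq, Set.mem_univ_pi,
      matVec, Matrix.toLin'_apply, eq_comm (a := x)]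
    rfl
  rw [h, show (WithLp.toLp 2 '' _ : Set (E n)) = WithLp.ofLp ⁻¹' _ from
      (WithLp.equiv 2 (Fin n → ℝ)).symm.image_eq_preimage_symm _,
    (PiLp.volume_preserving_ofLp (Fin n)).measure_preimage_emb
      (MeasurableEquiv.toLp 2 (Fin n → ℝ)).symm.measurableEmbedding,
    Measure.addHaar_image_linearMap, LinearMap.det_toLin', volume_pi, Measure.pi_pi]
  simp

theorem isAddFundamentalDomain_fundDomain {n : ℕ} (A : Matrix (Fin n) (Fin n) ℝ)
    (hA : IsUnit A.det) :
    IsAddFundamentalDomain (Submodule.span ℤ (Set.range (columnBasis A hA))).toAddSubgroup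
      (fundDomain A) volume := by
  rw [fundDomain_eq_fundamentalDomain A hA]
  exact ZSpan.isAddFundamentalDomain' _ _

theorem measurableSet_fundDomain {n : ℕ} (A : Matrix (Fin n) (Fin n) ℝ) (hA : IsUnit A.det) :
    MeasurableSet (fundDomain A) := by
  rw [fundDomain_eq_fundamentalDomain A hA]
  exact ZSpan.fundamentalDomain_measurableSet _

theorem integrableOn_fundDomain {n : ℕ} (A : Matrix (Fin n) (Fin n) ℝ) (hA : IsUnit A.det)
    {V : Type*} [NormedAddCommGroup V] {f : E n → V} (hf : Continuous f) :
    IntegrableOn f (fundDomain A) :=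
  (hf.continuousOn.integrableOn_compact (isBounded_fundDomain A hA).isCompact_closure).mono_set
    subset_closure

theorem setIntegral_fundDomain_add_right {n : ℕ} (A : Matrix (Fin n) (Fin n) ℝ)
    (hA : IsUnit A.det) {f : E n → ℝ} (hf : IsPeriodic (lattice A) f) (y : E n) :
    ∫ x in fundDomain A, f (x + y) = ∫ x in fundDomain A, f x := by
  have hF := isAddFundamentalDomain_fundDomain A hA
  have hper : ∀ (g : (Submodule.span ℤ (Set.range (columnBasis A hA))).toAddSubgroup) (x : E n),
      f (g +ᵥ x) = f x := by
    intro g x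
    have hg : (g : E n) ∈ lattice A := by
      rw [lattice_eq_span A hA]
      exact g.2
    rw [AddSubgroup.vadd_def, vadd_eq_add, add_comm]
    exact hf x g hg
  have : Countable (Submodule.span ℤ (Set.range (columnBasis A hA))).toAddSubgroup :=
    inferInstanceAs (Countable (Submodule.span ℤ (Set.range (columnBasis A hA))))
  rw [hF.setIntegral_eq (hF.vadd_of_comm y) hper, ← Set.image_vadd]
  simp only [vadd_eq_add, add_comm _ y]
  exact ((measurePreserving_add_left volume y).setIntegral_image_emb
    (measurableEmbedding_addLeft y) _ _).symm

theorem setIntegral_fundDomain_fderiv {n : ℕ} (A : Matrix (Fin n) (Fin n) ℝ)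
    (hA : IsUnit A.det) {f : E n → ℝ} (hf : IsPeriodic (lattice A) f) (hd : ContDiff ℝ 1 f)
    (y : E n) : ∫ x in fundDomain A, fderiv ℝ f x y = 0 := by
  have hcont : Continuous fun x => fderiv ℝ f x y :=
    (hd.continuous_fderiv one_ne_zero).clm_apply continuous_const
  have hK : IsCompact ((fun p : E n × ℝ => p.1 + p.2 • y) ''
      (closure (fundDomain A) ×ˢ Metric.closedBall (0 : ℝ) 1)) :=
    ((isBounded_fundDomain A hA).isCompact_closure.prod
      (isCompact_closedBall _ _)).image (by fun_prop)
  obtain ⟨C, hC⟩ := hK.exists_bound_of_continuousOn hcont.continuousOn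
  have key := (hasDerivAt_integral_of_dominated_loc_of_deriv_le
    (μ := volume.restrict (fundDomain A)) (F := fun (s : ℝ) x => f (x + s • y))
    (F' := fun s x => fderiv ℝ f (x + s • y) y) (x₀ := (0 : ℝ)) (bound := fun _ => C)
    (Metric.closedBall_mem_nhds (0 : ℝ) one_pos)
    (Eventually.of_forall fun s => by
      have := hd.continuous
      exact Continuous.aestronglyMeasurable (by fun_prop))
    (integrableOn_fundDomain A hA (by have := hd.continuous; fun_prop))
    (Continuous.aestronglyMeasurable (hcont.comp (by fun_prop)))
    ((ae_restrict_iff' (measurableSet_fundDomain A hA)).2 (Eventually.of_forall fun x hx s hs =>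
      hC _ ⟨(x, s), ⟨subset_closure hx, hs⟩, rfl⟩))
    (integrableOn_fundDomain A hA continuous_const)
    (Eventually.of_forall fun x s _ => by
      have h1 := ((hd.differentiable one_ne_zero) (x + s • y)).hasFDerivAt
      have h2 : HasDerivAt (fun s : ℝ => x + s • y) y s := by
        simpa using ((hasDerivAt_id s).smul_const y).const_add x
      exact h1.comp_hasDerivAt s h2)).2
  simp only [setIntegral_fundDomain_add_right A hA hf, zero_smul, add_zero] at key
  exact key.unique (hasDerivAt_const _ _)

theorem IsPeriodic.mul {n : ℕ} {Γ : Set (E n)} {f g : E n → ℝ} (hf : IsPeriodic Γ f)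
    (hg : IsPeriodic Γ g) : IsPeriodic Γ fun x => f x * g x :=
  fun x γ hγ => by simp only [hf x γ hγ, hg x γ hγ]

theorem IsPeriodic.sub {n : ℕ} {Γ : Set (E n)} {f g : E n → ℝ} (hf : IsPeriodic Γ f)
    (hg : IsPeriodic Γ g) : IsPeriodic Γ fun x => f x - g x :=
  fun x γ hγ => by simp only [hf x γ hγ, hg x γ hγ]

theorem IsPeriodic.const_mul {n : ℕ} {Γ : Set (E n)} {f : E n → ℝ} (hf : IsPeriodic Γ f)
    (c : ℝ) : IsPeriodic Γ fun x => c * f x :=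
  fun x γ hγ => by simp only [hf x γ hγ]

theorem IsPeriodic.fderiv_apply {n : ℕ} {Γ : Set (E n)} {f : E n → ℝ} (hf : IsPeriodic Γ f)
    (y : E n) : IsPeriodic Γ fun x => fderiv ℝ f x y := by
  intro x γ hγ
  have h : (fun z => f (z + γ)) = f := funext fun z => hf z γ hγ
  dsimp only
  rw [← fderiv_comp_add_right, h]

/-- The directional derivative along `y` of a smooth function is smooth. -/
theorem contDiff_fderiv_apply {n : ℕ} {f : E n → ℝ} (hf : ContDiff ℝ (⊤ : ℕ∞) f) (y : E n) :
    ContDiff ℝ (⊤ : ℕ∞) fun x => fderiv ℝ f x y :=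
  (hf.fderiv_right (m := (⊤ : ℕ∞)) le_rfl).clm_apply contDiff_const

theorem lap_eq_neg_sum_fderiv {n : ℕ} {f : E n → ℝ} (hf : ContDiff ℝ (⊤ : ℕ∞) f) (x : E n) :
    lap f x = -∑ i : Fin n, fderiv ℝ (fun y => fderiv ℝ f y (EuclideanSpace.single i 1)) x
      (EuclideanSpace.single i 1) := by
  have hd : DifferentiableAt ℝ (fderiv ℝ f) x :=
    (hf.fderiv_right (m := (⊤ : ℕ∞)) le_rfl).differentiable (by simp) x
  unfold lap
  congr 1
  refine Finset.sum_congr rfl fun i _ => ?_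
  rw [iteratedFDeriv_two_apply, fderiv_clm_apply hd (differentiableAt_const _)]
  simp

theorem lap_sub {n : ℕ} {f g : E n → ℝ} (hf : ContDiff ℝ (⊤ : ℕ∞) f)
    (hg : ContDiff ℝ (⊤ : ℕ∞) g) (x : E n) :
    lap (fun y => f y - g y) x = lap f x - lap g x := by
  have h : iteratedFDeriv ℝ 2 (fun y => f y - g y) x
      = iteratedFDeriv ℝ 2 f x - iteratedFDeriv ℝ 2 g x :=
    iteratedFDeriv_sub_apply (contDiff_infty.1 hf 2).contDiffAt
      (contDiff_infty.1 hg 2).contDiffAt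
  simp only [lap, h, sub_apply, Finset.sum_sub_distrib]
  ring

theorem lap_const_mul {n : ℕ} {f : E n → ℝ} (hf : ContDiff ℝ (⊤ : ℕ∞) f) (c : ℝ) (x : E n) :
    lap (fun y => c * f y) x = c * lap f x := by
  have h : iteratedFDeriv ℝ 2 (fun y => c * f y) x = c • iteratedFDeriv ℝ 2 f x :=
    iteratedFDeriv_const_smul_apply (a := c) (contDiff_infty.1 hf 2).contDiffAt
  simp only [lap, h, smul_apply, smul_eq_mul, ← Finset.mul_sum]
  ring

theorem continuous_lap {n : ℕ} {f : E n → ℝ} (hf : ContDiff ℝ (⊤ : ℕ∞) f) :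
    Continuous (lap f) := by
  rw [show lap f = _ from funext (lap_eq_neg_sum_fderiv hf)]
  exact (continuous_finsetSum _ fun i _ =>
    (contDiff_fderiv_apply (contDiff_fderiv_apply hf _) _).continuous).neg

/-- Green's formula: the Laplacian is symmetric on smooth periodic functions. -/
theorem setIntegral_lap_mul {n : ℕ} (A : Matrix (Fin n) (Fin n) ℝ) (hA : IsUnit A.det)
    {f g : E n → ℝ} (hf : ContDiff ℝ (⊤ : ℕ∞) f) (hfp : IsPeriodic (lattice A) f)
    (hg : ContDiff ℝ (⊤ : ℕ∞) g) (hgp : IsPeriodic (lattice A) g) :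
    ∫ x in fundDomain A, lap f x * g x = ∫ x in fundDomain A, f x * lap g x := by
  have hint : ∀ {h : E n → ℝ}, Continuous h → IntegrableOn h (fundDomain A) :=
    integrableOn_fundDomain A hA
  have hsub : ∫ x in fundDomain A, (lap f x * g x - f x * lap g x) =
      (∫ x in fundDomain A, lap f x * g x) - ∫ x in fundDomain A, f x * lap g x :=
    integral_sub (hint ((continuous_lap hf).mul hg.continuous))
      (hint (hf.continuous.mul (continuous_lap hg)))
  rw [← sub_eq_zero, ← hsub]
  set e : Fin n → E n := fun i => EuclideanSpace.single i 1 with he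
  have hsm : ∀ i, ContDiff ℝ (⊤ : ℕ∞)
      fun y => f y * fderiv ℝ g y (e i) - fderiv ℝ f y (e i) * g y := fun i =>
    (hf.mul (contDiff_fderiv_apply hg _)).sub ((contDiff_fderiv_apply hf _).mul hg)
  have hpt : ∀ x, lap f x * g x - f x * lap g x = ∑ i : Fin n,
      fderiv ℝ (fun y => f y * fderiv ℝ g y (e i) - fderiv ℝ f y (e i) * g y) x (e i) := by
    intro x
    rw [lap_eq_neg_sum_fderiv hf, lap_eq_neg_sum_fderiv hg, neg_mul, mul_neg, Finset.sum_mul,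
      Finset.mul_sum, sub_neg_eq_add, neg_add_eq_sub, ← Finset.sum_sub_distrib]
    refine Finset.sum_congr rfl fun i _ => ?_
    have h1 := hf.differentiable (by simp) x
    have h2 := hg.differentiable (by simp) x
    have h3 := (contDiff_fderiv_apply hf (e i)).differentiable (by simp) x
    have h4 := (contDiff_fderiv_apply hg (e i)).differentiable (by simp) x
    rw [fderiv_fun_sub (h1.fun_mul h4) (h3.fun_mul h2), fderiv_fun_mul h1 h4, fderiv_fun_mul h3 h2]
    simp only [he, sub_apply, add_apply, smul_apply, smul_eq_mul]
    ring
  simp only [hpt]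
  rw [integral_finsetSum _ fun i _ => hint (contDiff_fderiv_apply (hsm i) _).continuous]
  exact Finset.sum_eq_zero fun i _ => setIntegral_fundDomain_fderiv A hA
    ((hfp.mul (hgp.fderiv_apply _)).sub ((hfp.fderiv_apply _).mul hgp))
    (contDiff_infty.1 (hsm i) 1) _

/-- The plane wave `sin(2π⟨v,x⟩)`. -/
def sinWave {n : ℕ} (v x : E n) : ℝ := Real.sin (2 * π * ⟪v, x⟫_ℝ)

/-- The plane wave `cos(2π⟨v,x⟩)`. -/
def cosWave {n : ℕ} (v x : E n) : ℝ := Real.cos (2 * π * ⟪v, x⟫_ℝ)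

theorem contDiff_sinWave {n : ℕ} (v : E n) : ContDiff ℝ (⊤ : ℕ∞) (sinWave v) :=
  (contDiff_const.mul (contDiff_const.inner ℝ contDiff_id)).sin

theorem contDiff_cosWave {n : ℕ} (v : E n) : ContDiff ℝ (⊤ : ℕ∞) (cosWave v) :=
  (contDiff_const.mul (contDiff_const.inner ℝ contDiff_id)).cos

theorem isPeriodic_sinWave {n : ℕ} {Γ : Set (E n)} {v : E n} (hv : v ∈ dualLattice Γ) :
    IsPeriodic Γ (sinWave v) := by
  intro x γ hγ
  obtain ⟨k, hk⟩ := hv γ hγ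
  rw [sinWave, inner_add_right, hk, mul_add, mul_comm (2 * π) (k : ℝ),
    Real.sin_add_int_mul_two_pi, sinWave]

theorem isPeriodic_cosWave {n : ℕ} {Γ : Set (E n)} {v : E n} (hv : v ∈ dualLattice Γ) :
    IsPeriodic Γ (cosWave v) := by
  intro x γ hγ
  obtain ⟨k, hk⟩ := hv γ hγ
  rw [cosWave, inner_add_right, hk, mul_add, mul_comm (2 * π) (k : ℝ),
    Real.cos_add_int_mul_two_pi, cosWave]

theorem hasFDerivAt_two_pi_inner {n : ℕ} (v x : E n) :
    HasFDerivAt (fun y : E n => 2 * π * ⟪v, y⟫_ℝ) ((2 * π) • innerSL ℝ v) x :=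
  ((innerSL ℝ v).hasFDerivAt).const_mul _

theorem fderiv_sinWave {n : ℕ} (v x y : E n) :
    fderiv ℝ (sinWave v) x y = 2 * π * ⟪v, y⟫_ℝ * cosWave v x := by
  rw [show fderiv ℝ (sinWave v) x = _ from (hasFDerivAt_two_pi_inner v x).sin.fderiv]
  simp [cosWave]
  ring

theorem fderiv_cosWave {n : ℕ} (v x y : E n) :
    fderiv ℝ (cosWave v) x y = -(2 * π * ⟪v, y⟫_ℝ) * sinWave v x := by
  rw [show fderiv ℝ (cosWave v) x = _ from (hasFDerivAt_two_pi_inner v x).cos.fderiv]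
  simp [sinWave]
  ring

theorem lap_sinWave {n : ℕ} (v x : E n) :
    lap (sinWave v) x = 4 * π ^ 2 * ‖v‖ ^ 2 * sinWave v x := by
  rw [lap_eq_neg_sum_fderiv (contDiff_sinWave v)]
  simp only [fderiv_sinWave]
  simp only [fderiv_const_mul ((contDiff_cosWave v).differentiable (by simp) x), smul_apply,
    fderiv_cosWave, smul_eq_mul, EuclideanSpace.norm_sq_eq, Finset.mul_sum, Finset.sum_mul,
    ← Finset.sum_neg_distrib, EuclideanSpace.inner_single_right]
  refine Finset.sum_congr rfl fun i _ => ?_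
  simp
  ring

theorem lap_cosWave {n : ℕ} (v x : E n) :
    lap (cosWave v) x = 4 * π ^ 2 * ‖v‖ ^ 2 * cosWave v x := by
  rw [lap_eq_neg_sum_fderiv (contDiff_cosWave v)]
  simp only [fderiv_cosWave]
  simp only [fderiv_const_mul ((contDiff_sinWave v).differentiable (by simp) x), smul_apply,
    fderiv_sinWave, smul_eq_mul, EuclideanSpace.norm_sq_eq, Finset.mul_sum, Finset.sum_mul,
    ← Finset.sum_neg_distrib, EuclideanSpace.inner_single_right]
  refine Finset.sum_congr rfl fun i _ => ?_
  simp
  ring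

theorem setIntegral_cosWave_eq_zero {n : ℕ} (A : Matrix (Fin n) (Fin n) ℝ) (hA : IsUnit A.det)
    {v : E n} (hv : v ∈ dualLattice (lattice A)) (hv0 : v ≠ 0) :
    ∫ x in fundDomain A, cosWave v x = 0 := by
  have h := setIntegral_fundDomain_fderiv A hA (isPeriodic_sinWave hv)
    (contDiff_infty.1 (contDiff_sinWave v) 1) v
  simp only [fderiv_sinWave, integral_const_mul, real_inner_self_eq_norm_sq] at h
  have : 2 * π * ‖v‖ ^ 2 ≠ 0 := by have := norm_pos_iff.2 hv0; positivity
  exact (mul_eq_zero.1 h).resolve_left this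

theorem setIntegral_sinWave_eq_zero {n : ℕ} (A : Matrix (Fin n) (Fin n) ℝ) (hA : IsUnit A.det)
    {v : E n} (hv : v ∈ dualLattice (lattice A)) (hv0 : v ≠ 0) :
    ∫ x in fundDomain A, sinWave v x = 0 := by
  have h := setIntegral_fundDomain_fderiv A hA (isPeriodic_cosWave hv)
    (contDiff_infty.1 (contDiff_cosWave v) 1) v
  simp only [fderiv_cosWave, integral_const_mul, real_inner_self_eq_norm_sq] at h
  have : -(2 * π * ‖v‖ ^ 2) ≠ 0 := by
    have := norm_pos_iff.2 hv0
    exact neg_ne_zero.2 (by positivity)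
  exact (mul_eq_zero.1 h).resolve_left this

theorem setIntegral_fundDomain_const {n : ℕ} (A : Matrix (Fin n) (Fin n) ℝ) (c : ℝ) :
    ∫ _ in fundDomain A, c = |A.det| * c := by
  simp [Measure.real, volume_fundDomain]

theorem add_self_mem_dualLattice {n : ℕ} {Γ : Set (E n)} {v : E n} (hv : v ∈ dualLattice Γ) :
    v + v ∈ dualLattice Γ := by
  intro x hx
  obtain ⟨k, hk⟩ := hv x hx
  exact ⟨k + k, by rw [inner_add_left, hk]; push_cast; ring⟩

theorem two_pi_inner_add_self {n : ℕ} (v x : E n) :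
    2 * π * ⟪v + v, x⟫_ℝ = 2 * (2 * π * ⟪v, x⟫_ℝ) := by
  rw [inner_add_left]
  ring

theorem setIntegral_sinWave_mul_self {n : ℕ} (A : Matrix (Fin n) (Fin n) ℝ)
    (hA : IsUnit A.det) {v : E n} (hv : v ∈ dualLattice (lattice A)) (hv0 : v ≠ 0) :
    ∫ x in fundDomain A, sinWave v x * sinWave v x = |A.det| / 2 := by
  have h : ∀ x, sinWave v x * sinWave v x = 1 / 2 - 1 / 2 * cosWave (v + v) x := by
    intro x
    rw [sinWave, cosWave, two_pi_inner_add_self, ← pow_two, Real.sin_sq_eq_half_sub]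
    ring
  simp only [h]
  rw [integral_sub (integrableOn_fundDomain A hA continuous_const)
      (integrableOn_fundDomain A hA ((contDiff_cosWave _).continuous.const_mul _)),
    setIntegral_fundDomain_const, integral_const_mul,
    setIntegral_cosWave_eq_zero A hA (add_self_mem_dualLattice hv)
      (by simpa [← two_smul ℝ] using hv0)]
  ring

theorem setIntegral_cosWave_mul_self {n : ℕ} (A : Matrix (Fin n) (Fin n) ℝ)
    (hA : IsUnit A.det) {v : E n} (hv : v ∈ dualLattice (lattice A)) (hv0 : v ≠ 0) :
    ∫ x in fundDomain A, cosWave v x * cosWave v x = |A.det| / 2 := by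
  have h : ∀ x, cosWave v x * cosWave v x = 1 / 2 + 1 / 2 * cosWave (v + v) x := by
    intro x
    rw [cosWave, cosWave, two_pi_inner_add_self, ← pow_two, Real.cos_sq]
    ring
  simp only [h]
  rw [integral_add (integrableOn_fundDomain A hA continuous_const)
      (integrableOn_fundDomain A hA ((contDiff_cosWave _).continuous.const_mul _)),
    setIntegral_fundDomain_const, integral_const_mul,
    setIntegral_cosWave_eq_zero A hA (add_self_mem_dualLattice hv)
      (by simpa [← two_smul ℝ] using hv0)]
  ring

theorem setIntegral_sinWave_mul_cosWave {n : ℕ} (A : Matrix (Fin n) (Fin n) ℝ)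
    (hA : IsUnit A.det) {v : E n} (hv : v ∈ dualLattice (lattice A)) (hv0 : v ≠ 0) :
    ∫ x in fundDomain A, sinWave v x * cosWave v x = 0 := by
  have h : ∀ x, sinWave v x * cosWave v x = 1 / 2 * sinWave (v + v) x := by
    intro x
    rw [sinWave, cosWave, sinWave, two_pi_inner_add_self, Real.sin_two_mul]
    ring
  simp only [h]
  rw [integral_const_mul,
    setIntegral_sinWave_eq_zero A hA (add_self_mem_dualLattice hv)
      (by simpa [← two_smul ℝ] using hv0), mul_zero]

/-- The projection `ℝⁿ → ℝⁿ/Γ ≅ (ℝ/ℤ)ⁿ`. -/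
def toTorus {n : ℕ} (A : Matrix (Fin n) (Fin n) ℝ) (hA : IsUnit A.det) (x : E n) :
    UnitAddTorus (Fin n) :=
  fun i => ((columnBasis A hA).repr x i : UnitAddCircle)

theorem isOpenQuotientMap_toTorus {n : ℕ} (A : Matrix (Fin n) (Fin n) ℝ) (hA : IsUnit A.det) :
    IsOpenQuotientMap (toTorus A hA) :=
  (IsOpenQuotientMap.piMap fun _ : Fin n => QuotientAddGroup.isOpenQuotientMap_mk).comp
    (columnBasis A hA).equivFun.toContinuousLinearEquiv.toHomeomorph.isOpenQuotientMap

theorem IsPeriodic.eq_of_toTorus_eq {n : ℕ} {A : Matrix (Fin n) (Fin n) ℝ} (hA : IsUnit A.det)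
    {f : E n → ℝ} (hf : IsPeriodic (lattice A) f) {x y : E n}
    (h : toTorus A hA x = toTorus A hA y) : f x = f y := by
  have hmem : x - y ∈ lattice A := by
    rw [lattice_eq_span A hA, SetLike.mem_coe, Module.Basis.mem_span_iff_repr_mem]
    intro i
    have hi : (((columnBasis A hA).repr (x - y) i : ℝ) : UnitAddCircle) = 0 := by
      rw [map_sub, Finsupp.sub_apply, AddCircle.coe_sub, sub_eq_zero]
      exact congrFun h i
    obtain ⟨k, hk⟩ := (AddCircle.coe_eq_zero_iff _).1 hi
    exact ⟨k, by simpa using hk⟩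
  simpa using hf y _ hmem

/-- The dual lattice vector with integer coordinates `k` in the basis dual to the columns. -/
theorem exists_mem_dualLattice_inner_eq {n : ℕ} (A : Matrix (Fin n) (Fin n) ℝ)
    (hA : IsUnit A.det) (k : Fin n → ℤ) : ∃ v ∈ dualLattice (lattice A),
      ∀ x, ⟪v, x⟫_ℝ = ∑ i, k i * (columnBasis A hA).repr x i := by
  set l : E n →ₗ[ℝ] ℝ := ∑ i, (k i : ℝ) • (columnBasis A hA).coord i with hl
  have hv : ∀ x, ⟪(InnerProductSpace.toDual ℝ (E n)).symm (LinearMap.toContinuousLinearMap l),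
      x⟫_ℝ = ∑ i, k i * (columnBasis A hA).repr x i := by
    intro x
    rw [InnerProductSpace.toDual_symm_apply]
    simp [hl]
  refine ⟨_, ?_, hv⟩
  rintro x ⟨m, rfl⟩
  refine ⟨∑ i, k i * m i, ?_⟩
  rw [hv]
  simp [columnBasis_repr_matVec]

theorem mFourier_toTorus {n : ℕ} (A : Matrix (Fin n) (Fin n) ℝ) (hA : IsUnit A.det)
    (k : Fin n → ℤ) {v : E n} {x : E n}
    (hv : ⟪v, x⟫_ℝ = ∑ i, k i * (columnBasis A hA).repr x i) :
    UnitAddTorus.mFourier k (toTorus A hA x) = cosWave v x + sinWave v x * Complex.I := by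
  have h : UnitAddTorus.mFourier k (toTorus A hA x) =
      Complex.exp ((2 * π * ⟪v, x⟫_ℝ : ℝ) * Complex.I) := by
    rw [hv]
    simp only [UnitAddTorus.mFourier, toTorus, ContinuousMap.coe_mk, fourier_coe_apply,
      ← Complex.exp_sum]
    congr 1
    push_cast
    rw [Finset.mul_sum, Finset.sum_mul]
    refine Finset.sum_congr rfl fun i _ => ?_
    ring
  rw [h, Complex.exp_mul_I, cosWave, sinWave, Complex.ofReal_cos, Complex.ofReal_sin]

/-- Integration of `f` over the fundamental domain against functions on the torus. -/
def torusPairing {n : ℕ} (A : Matrix (Fin n) (Fin n) ℝ) (hA : IsUnit A.det) {f : E n → ℝ}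
    (hf : Continuous f) : C(UnitAddTorus (Fin n), ℂ) →L[ℂ] ℂ :=
  have hint : ∀ φ : C(UnitAddTorus (Fin n), ℂ),
      IntegrableOn (fun x => (f x : ℂ) * φ (toTorus A hA x)) (fundDomain A) := fun φ =>
    integrableOn_fundDomain A hA ((Complex.continuous_ofReal.comp hf).mul
      (φ.continuous.comp (isOpenQuotientMap_toTorus A hA).continuous))
  LinearMap.mkContinuous
    { toFun := fun φ => ∫ x in fundDomain A, (f x : ℂ) * φ (toTorus A hA x)
      map_add' := fun φ ψ => by
        rw [← integral_add (hint φ) (hint ψ)]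
        simp [mul_add]
      map_smul' := fun c φ => by
        rw [RingHom.id_apply, smul_eq_mul, ← integral_const_mul]
        simp [mul_left_comm] }
    (∫ x in fundDomain A, |f x|) fun φ => by
      rw [← integral_mul_const]
      refine norm_integral_le_of_norm_le
        (integrableOn_fundDomain A hA (by fun_prop)) (Eventually.of_forall fun x => ?_)
      rw [norm_mul, Complex.norm_real, Real.norm_eq_abs]
      gcongr
      exact φ.norm_coe_le_norm _

theorem torusPairing_apply {n : ℕ} (A : Matrix (Fin n) (Fin n) ℝ) (hA : IsUnit A.det)
    {f : E n → ℝ} (hf : Continuous f) (φ : C(UnitAddTorus (Fin n), ℂ)) :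
    torusPairing A hA hf φ = ∫ x in fundDomain A, (f x : ℂ) * φ (toTorus A hA x) :=
  rfl

/-- A continuous periodic function with vanishing Fourier coefficients is zero. -/
theorem eq_zero_of_setIntegral_mul_wave_eq_zero {n : ℕ} (A : Matrix (Fin n) (Fin n) ℝ)
    (hA : IsUnit A.det) {f : E n → ℝ} (hf : Continuous f) (hp : IsPeriodic (lattice A) f)
    (hcos : ∀ v ∈ dualLattice (lattice A), ∫ x in fundDomain A, f x * cosWave v x = 0)
    (hsin : ∀ v ∈ dualLattice (lattice A), ∫ x in fundDomain A, f x * sinWave v x = 0) :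
    f = 0 := by
  have hq := isOpenQuotientMap_toTorus A hA
  have hpair : torusPairing A hA hf = 0 := by
    refine ContinuousLinearMap.ext_on (s := Set.range UnitAddTorus.mFourier) ?_ ?_
    · rw [Submodule.dense_iff_topologicalClosure_eq_top]
      exact UnitAddTorus.span_mFourier_closure_eq_top
    · rintro _ ⟨k, rfl⟩
      obtain ⟨v, hv, hvx⟩ := exists_mem_dualLattice_inner_eq A hA k
      have hc : IntegrableOn (fun x => ((f x * cosWave v x : ℝ) : ℂ)) (fundDomain A) :=
        integrableOn_fundDomain A hA (Complex.continuous_ofReal.comp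
          (hf.mul (contDiff_cosWave v).continuous))
      have hs : IntegrableOn (fun x => ((f x * sinWave v x : ℝ) : ℂ) * Complex.I)
          (fundDomain A) :=
        integrableOn_fundDomain A hA ((Complex.continuous_ofReal.comp
          (hf.mul (contDiff_sinWave v).continuous)).mul continuous_const)
      have hsplit : ∀ x, (f x : ℂ) * UnitAddTorus.mFourier k (toTorus A hA x) =
          ((f x * cosWave v x : ℝ) : ℂ) + ((f x * sinWave v x : ℝ) : ℂ) * Complex.I := by
        intro x
        rw [mFourier_toTorus A hA k (hvx x)]
        push_cast
        ring
      rw [torusPairing_apply]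
      simp only [hsplit]
      rw [integral_add hc hs, integral_mul_const, integral_complex_ofReal,
        integral_complex_ofReal, hcos v hv, hsin v hv]
      simp
  obtain ⟨φ, hφ⟩ : ∃ φ : C(UnitAddTorus (Fin n), ℂ), ∀ x, φ (toTorus A hA x) = f x := by
    have hlift : ∀ x, (f (Function.surjInv hq.surjective (toTorus A hA x)) : ℂ) = f x :=
      fun x => congrArg _ (hp.eq_of_toTorus_eq hA (Function.surjInv_eq hq.surjective _))
    refine ⟨⟨fun z => f (Function.surjInv hq.surjective z), ?_⟩, hlift⟩
    rw [hq.isQuotientMap.continuous_iff]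
    exact (Complex.continuous_ofReal.comp hf).congr fun x => (hlift x).symm
  have hsq : ∫ x in fundDomain A, f x * f x = 0 := by
    have h := torusPairing_apply A hA hf φ
    simp only [hφ, hpair, zero_apply, ← Complex.ofReal_mul, integral_complex_ofReal] at h
    exact_mod_cast h.symm
  rw [integral_eq_zero_iff_of_nonneg (fun x => mul_self_nonneg (f x))
    (integrableOn_fundDomain A hA (hf.mul hf))] at hsq
  have hnull : volume ({x | f x ≠ 0} ∩ fundDomain A) = 0 := by
    have h := (ae_restrict_iff' (measurableSet_fundDomain A hA)).1 hsq
    refine measure_mono_null ?_ h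
    rintro x ⟨hx, hxF⟩ h0
    exact hx (mul_self_eq_zero.1 (h0 hxF))
  have : Countable (Submodule.span ℤ (Set.range (columnBasis A hA))).toAddSubgroup :=
    inferInstanceAs (Countable (Submodule.span ℤ (Set.range (columnBasis A hA))))
  have hzero := (isAddFundamentalDomain_fundDomain A hA).measure_zero_of_invariant
    {x | f x ≠ 0} (fun g => by
      ext x
      have hg : (-g : E n) ∈ lattice A := by
        rw [lattice_eq_span A hA]
        exact neg_mem g.2
      rw [Set.mem_vadd_set_iff_neg_vadd_mem, AddSubgroup.vadd_def, vadd_eq_add, add_comm]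
      simp [hp x _ hg]) hnull
  exact (hf.ae_eq_iff_eq volume continuous_const).1 hzero

theorem setIntegral_eigenfunction_mul_eq_zero {n : ℕ} (A : Matrix (Fin n) (Fin n) ℝ)
    (hA : IsUnit A.det) {f g : E n → ℝ} {lam μ : ℝ} (hf : ContDiff ℝ (⊤ : ℕ∞) f)
    (hfp : IsPeriodic (lattice A) f) (hfe : ∀ x, lap f x = lam * f x)
    (hg : ContDiff ℝ (⊤ : ℕ∞) g) (hgp : IsPeriodic (lattice A) g)
    (hge : ∀ x, lap g x = μ * g x) (hne : lam ≠ μ) :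
    ∫ x in fundDomain A, f x * g x = 0 := by
  have h := setIntegral_lap_mul A hA hf hfp hg hgp
  simp only [hfe, hge, mul_assoc, mul_left_comm _ μ, integral_const_mul] at h
  have h2 : (lam - μ) * ∫ x in fundDomain A, f x * g x = 0 := by rw [sub_mul, h, sub_self]
  exact (mul_eq_zero.1 h2).resolve_left (sub_ne_zero.2 hne)

/-- A smooth periodic eigenfunction orthogonal to all plane waves of its own eigenvalue
vanishes. -/
theorem eigenfunction_eq_zero {n : ℕ} (A : Matrix (Fin n) (Fin n) ℝ)
    (hA : IsUnit A.det) {f : E n → ℝ} {lam : ℝ} (hf : ContDiff ℝ (⊤ : ℕ∞) f)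
    (hfp : IsPeriodic (lattice A) f) (hfe : ∀ x, lap f x = lam * f x)
    (h : ∀ v ∈ dualLattice (lattice A), lam = 4 * π ^ 2 * ‖v‖ ^ 2 →
      (∫ x in fundDomain A, f x * cosWave v x) = 0 ∧
      (∫ x in fundDomain A, f x * sinWave v x) = 0) : f = 0 := by
  refine eq_zero_of_setIntegral_mul_wave_eq_zero A hA hf.continuous hfp (fun v hv => ?_)
    fun v hv => ?_
  all_goals by_cases hl : lam = 4 * π ^ 2 * ‖v‖ ^ 2
  · exact (h v hv hl).1
  · exact setIntegral_eigenfunction_mul_eq_zero A hA hf hfp hfe (contDiff_cosWave v)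
      (isPeriodic_cosWave hv) (lap_cosWave v) hl
  · exact (h v hv hl).2
  · exact setIntegral_eigenfunction_mul_eq_zero A hA hf hfp hfe (contDiff_sinWave v)
      (isPeriodic_sinWave hv) (lap_sinWave v) hl

theorem sinWave_neg {n : ℕ} (v x : E n) : sinWave (-v) x = -sinWave v x := by
  simp [sinWave]

theorem cosWave_neg {n : ℕ} (v x : E n) : cosWave (-v) x = cosWave v x := by
  simp [cosWave]

/-- Under the gap condition, an eigenfunction for `4π²|w|²` is a combination of the two plane
waves of frequency `w`. -/
theorem GapCondition.eq_add_of_lap_eq {n : ℕ} {A : Matrix (Fin n) (Fin n) ℝ}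
    (hA : IsUnit A.det) {w : E n} (hgap : GapCondition (lattice A) w) {f : E n → ℝ}
    (hf : ContDiff ℝ (⊤ : ℕ∞) f) (hfp : IsPeriodic (lattice A) f)
    (hfe : ∀ x, lap f x = 4 * π ^ 2 * ‖w‖ ^ 2 * f x) :
    ∃ a b : ℝ, ∀ x, f x = a * sinWave w x + b * cosWave w x := by
  obtain ⟨hw, hw0, hmin⟩ := hgap
  have hD : |A.det| ≠ 0 := abs_ne_zero.2 hA.ne_zero
  set a := 2 / |A.det| * ∫ x in fundDomain A, f x * sinWave w x with ha
  set b := 2 / |A.det| * ∫ x in fundDomain A, f x * cosWave w x with hb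
  have hs := contDiff_sinWave w
  have hc := contDiff_cosWave w
  have has : ContDiff ℝ (⊤ : ℕ∞) fun x => a * sinWave w x := contDiff_const.mul hs
  have hbc : ContDiff ℝ (⊤ : ℕ∞) fun x => b * cosWave w x := contDiff_const.mul hc
  have hint : ∀ {h : E n → ℝ}, Continuous h → IntegrableOn h (fundDomain A) :=
    integrableOn_fundDomain A hA
  have hexp : ∀ {p : E n → ℝ}, Continuous p →
      ∫ x in fundDomain A, (f x - a * sinWave w x - b * cosWave w x) * p x =
        (∫ x in fundDomain A, f x * p x) - a * (∫ x in fundDomain A, sinWave w x * p x)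
          - b * ∫ x in fundDomain A, cosWave w x * p x := by
    intro p hp
    simp only [sub_mul, mul_assoc]
    have h1 : IntegrableOn (fun x => f x * p x) (fundDomain A) := hint (hf.continuous.mul hp)
    have h2 : IntegrableOn (fun x => a * (sinWave w x * p x)) (fundDomain A) :=
      hint (continuous_const.mul (hs.continuous.mul hp))
    have h3 : IntegrableOn (fun x => b * (cosWave w x * p x)) (fundDomain A) :=
      hint (continuous_const.mul (hc.continuous.mul hp))
    rw [integral_sub (by exact h1.sub h2) h3, integral_sub h1 h2, integral_const_mul,
      integral_const_mul]
  have horthC : ∫ x in fundDomain A,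
      (f x - a * sinWave w x - b * cosWave w x) * cosWave w x = 0 := by
    rw [hexp hc.continuous, setIntegral_sinWave_mul_cosWave A hA hw hw0,
      setIntegral_cosWave_mul_self A hA hw hw0, hb]
    field_simp
    ring
  have horthS : ∫ x in fundDomain A,
      (f x - a * sinWave w x - b * cosWave w x) * sinWave w x = 0 := by
    have hcs : ∫ x in fundDomain A, cosWave w x * sinWave w x = 0 := by
      simp only [mul_comm (cosWave w _)]
      exact setIntegral_sinWave_mul_cosWave A hA hw hw0
    rw [hexp hs.continuous, hcs, setIntegral_sinWave_mul_self A hA hw hw0, ha]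
    field_simp
    ring
  have hzero := eigenfunction_eq_zero A hA (lam := 4 * π ^ 2 * ‖w‖ ^ 2) ((hf.sub has).sub hbc)
    ((hfp.sub ((isPeriodic_sinWave hw).const_mul a)).sub ((isPeriodic_cosWave hw).const_mul b))
    (fun x => by
      rw [lap_sub (hf.sub has) hbc, lap_sub hf has, lap_const_mul hs, lap_const_mul hc, hfe,
        lap_sinWave, lap_cosWave]
      ring)
    (fun v hv hl => by
      have hnorm : ‖w‖ = ‖v‖ :=
        (sq_eq_sq₀ (norm_nonneg _) (norm_nonneg _)).1 (mul_left_cancel₀ (by positivity) hl)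
      have hv0 : v ≠ 0 := norm_ne_zero_iff.1 (hnorm ▸ norm_ne_zero_iff.2 hw0)
      by_cases h1 : v = w
      · subst h1
        exact ⟨horthC, horthS⟩
      by_cases h2 : v = -w
      · subst h2
        simp only [cosWave_neg, sinWave_neg, mul_neg, integral_neg, neg_eq_zero]
        exact ⟨horthC, horthS⟩
      exact absurd hnorm (hmin v hv hv0 h1 h2).ne)
  exact ⟨a, b, fun x => by
    have hx : f x - a * sinWave w x - b * cosWave w x = 0 := congrFun hzero x
    linear_combination hx⟩

theorem GapCondition.le_of_lap_eq {n : ℕ} {A : Matrix (Fin n) (Fin n) ℝ}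
    (hA : IsUnit A.det) {w : E n} (hgap : GapCondition (lattice A) w) {f : E n → ℝ} {lam : ℝ}
    (hf : ContDiff ℝ (⊤ : ℕ∞) f) (hfp : IsPeriodic (lattice A) f) (hf0 : f ≠ 0)
    (hfe : ∀ x, lap f x = lam * f x) (hlam : 0 < lam) : 4 * π ^ 2 * ‖w‖ ^ 2 ≤ lam := by
  obtain ⟨-, -, hmin⟩ := hgap
  by_contra! hlt
  refine hf0 (eigenfunction_eq_zero A hA hf hfp hfe fun v hv hl => ?_)
  have hle : ‖w‖ ≤ ‖v‖ := by
    have hv0 : v ≠ 0 := by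
      rintro rfl
      simp [hl] at hlam
    by_cases h1 : v = w
    · rw [h1]
    by_cases h2 : v = -w
    · rw [h2, norm_neg]
    exact (hmin v hv hv0 h1 h2).le
  have : 4 * π ^ 2 * ‖w‖ ^ 2 ≤ 4 * π ^ 2 * ‖v‖ ^ 2 := by gcongr
  linarith

/-- Under the gap condition, the `λ₁ = 4π²|w|²`-eigenspace of the Laplacian on smooth
`Γ`-periodic functions is two-dimensional, spanned by the `L²(F)`-orthonormal functions
`u₁, u₂`, and every positive eigenvalue of a smooth `Γ`-periodic eigenfunction is `≥ λ₁`. -/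
theorem statement1 (n : ℕ) (hn : 2 ≤ n) (A : Matrix (Fin n) (Fin n) ℝ) (hA : IsUnit A.det)
    (w : E n) (hgap : GapCondition (lattice A) w)
    (lam₁ : ℝ) (hlam₁ : lam₁ = 4 * π ^ 2 * ‖w‖ ^ 2)
    (u₁ u₂ : E n → ℝ) (hu₁ : u₁ = uSin A w) (hu₂ : u₂ = uCos A w) :
    -- `u₁` and `u₂` are smooth `Γ`-periodic `λ₁`-eigenfunctions
    (ContDiff ℝ (⊤ : ℕ∞) u₁ ∧ IsPeriodic (lattice A) u₁ ∧ ∀ x, lap u₁ x = lam₁ * u₁ x) ∧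
    (ContDiff ℝ (⊤ : ℕ∞) u₂ ∧ IsPeriodic (lattice A) u₂ ∧ ∀ x, lap u₂ x = lam₁ * u₂ x) ∧
    -- they are linearly independent and span the eigenspace, so it is two-dimensional
    LinearIndependent ℝ ![u₁, u₂] ∧
    (∀ f : E n → ℝ, ContDiff ℝ (⊤ : ℕ∞) f → IsPeriodic (lattice A) f →
      (∀ x, lap f x = lam₁ * f x) → ∃ a b : ℝ, f = fun x => a * u₁ x + b * u₂ x) ∧
    -- `u₁, u₂` are orthonormal in `L²(F)`
    (∫ x in fundDomain A, u₁ x * u₁ x) = 1 ∧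
    (∫ x in fundDomain A, u₂ x * u₂ x) = 1 ∧
    (∫ x in fundDomain A, u₁ x * u₂ x) = 0 ∧
    -- every positive eigenvalue is `≥ λ₁`
    (∀ (f : E n → ℝ) (lam : ℝ), ContDiff ℝ (⊤ : ℕ∞) f → IsPeriodic (lattice A) f → f ≠ 0 →
      (∀ x, lap f x = lam * f x) → 0 < lam → lam₁ ≤ lam) := by
  have hD : 0 < |A.det| := abs_pos.2 hA.ne_zero
  obtain ⟨c, hc⟩ : ∃ c, c = √2 / √|A.det| := ⟨_, rfl⟩
  have hc0 : c ≠ 0 := by rw [hc]; positivity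
  have hcc : c * c * (|A.det| / 2) = 1 := by
    rw [hc, div_mul_div_comm, Real.mul_self_sqrt zero_le_two, Real.mul_self_sqrt hD.le]
    field_simp
  replace hu₁ : u₁ = fun x => c * sinWave w x := by rw [hu₁, hc]; rfl
  replace hu₂ : u₂ = fun x => c * cosWave w x := by rw [hu₂, hc]; rfl
  obtain ⟨hw, hw0, -⟩ := id hgap
  subst hu₁ hu₂ hlam₁
  refine ⟨⟨contDiff_const.mul (contDiff_sinWave w), (isPeriodic_sinWave hw).const_mul c,
      fun x => ?_⟩, ⟨contDiff_const.mul (contDiff_cosWave w),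
      (isPeriodic_cosWave hw).const_mul c, fun x => ?_⟩, ?_, fun f hf hfp hfe => ?_, ?_, ?_, ?_,
    fun f lam hf hfp hf0 hfe hlam => hgap.le_of_lap_eq hA hf hfp hf0 hfe hlam⟩
  · rw [lap_const_mul (contDiff_sinWave w), lap_sinWave]
    ring
  · rw [lap_const_mul (contDiff_cosWave w), lap_cosWave]
    ring
  · rw [LinearIndependent.pair_iff]
    intro s t hst
    have h0 := congrFun hst 0
    have h1 := congrFun hst ((1 / (4 * ‖w‖ ^ 2)) • w)
    have hq : 2 * π * ⟪w, (1 / (4 * ‖w‖ ^ 2)) • w⟫_ℝ = π / 2 := by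
      rw [inner_smul_right, real_inner_self_eq_norm_sq]
      have := norm_ne_zero_iff.2 hw0
      field_simp
      ring
    simp [sinWave, cosWave, hc0] at h0
    simp only [Pi.add_apply, Pi.smul_apply, sinWave, cosWave, hq] at h1
    simp [hc0] at h1
    exact ⟨h1, h0⟩
  · obtain ⟨a, b, hab⟩ := hgap.eq_add_of_lap_eq hA hf hfp hfe
    refine ⟨a / c, b / c, funext fun x => ?_⟩
    rw [hab]
    field_simp
  · simp only [mul_mul_mul_comm c _ c, integral_const_mul]
    rw [setIntegral_sinWave_mul_self A hA hw hw0, hcc]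
  · simp only [mul_mul_mul_comm c _ c, integral_const_mul]
    rw [setIntegral_cosWave_mul_self A hA hw hw0, hcc]
  · simp only [mul_mul_mul_comm c _ c, integral_const_mul]
    rw [setIntegral_sinWave_mul_cosWave A hA hw hw0, mul_zero]
end
end

section
/- Under the gap condition, set φ := u₁ and c(x) := cos(4π⟨w,x⟩), and define S₁ : ℝⁿ → ℝ by S₁ := λ₁·φ²·u₁ + (8λ₁/(3D))·φ·c + (n−2)·φ·⟨∇φ, ∇u₁⟩ − ((n−2)/(3λ₁))·( 4λ₁·φ·(λ₁/D)·c + λ₁·⟨∇φ, ∇(−c/D)⟩ ) − ((n−2)²/(6λ₁))·⟨∇φ, ∇((λ₁/D)·c)⟩. Then for every x ∈ ℝⁿ, S₁(x) = (λ₁·(n² + n − 5)/(6D))·u₁(x) + (√2·λ₁·(n² − 7n + 15)/(6·D^{3/2}))·sin(6π⟨w,x⟩). -/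
open MeasureTheory Real Filter Topology Asymptotics
open scoped InnerProductSpace

noncomputable section

/-- Gradient of `y ↦ g ⟪w, y⟫` for a function `g` of one real variable. -/
theorem gradient_comp_inner {F : Type*} [NormedAddCommGroup F] [InnerProductSpace ℝ F]
    [CompleteSpace F] {g : ℝ → ℝ} {g' : ℝ} (w x : F) (hg : HasDerivAt g g' ⟪w, x⟫_ℝ) :
    gradient (fun y => g ⟪w, y⟫_ℝ) x = g' • w := by
  refine HasGradientAt.gradient ?_
  have h : HasFDerivAt (fun y : F => ⟪w, y⟫_ℝ) (innerSL ℝ w) x := (innerSL ℝ w).hasFDerivAt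
  rw [hasGradientAt_iff_hasFDerivAt]
  refine (hg.comp_hasFDerivAt x h).congr_fderiv ?_
  ext y
  simp

theorem gradient_const_mul_sin_inner {F : Type*} [NormedAddCommGroup F] [InnerProductSpace ℝ F]
    [CompleteSpace F] (k b : ℝ) (w x : F) :
    gradient (fun y => k * Real.sin (b * ⟪w, y⟫_ℝ)) x = (k * b * Real.cos (b * ⟪w, x⟫_ℝ)) • w := by
  refine gradient_comp_inner (g := fun t => k * Real.sin (b * t)) w x ?_
  exact ((((hasDerivAt_id' ⟪w, x⟫_ℝ).const_mul b).sin).const_mul k).congr_deriv (by ring)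

theorem gradient_const_mul_cos_inner {F : Type*} [NormedAddCommGroup F] [InnerProductSpace ℝ F]
    [CompleteSpace F] (k b : ℝ) (w x : F) :
    gradient (fun y => k * Real.cos (b * ⟪w, y⟫_ℝ)) x =
      (-(k * b * Real.sin (b * ⟪w, x⟫_ℝ))) • w := by
  refine gradient_comp_inner (g := fun t => k * Real.cos (b * t)) w x ?_
  exact ((((hasDerivAt_id' ⟪w, x⟫_ℝ).const_mul b).cos).const_mul k).congr_deriv (by ring)

/-- Explicit computation of `S_{1,φ}(u₁)` for `φ = u₁` on the flat torus. -/
theorem statement4 (n : ℕ) (hn : 2 ≤ n) (A : Matrix (Fin n) (Fin n) ℝ) (hA : IsUnit A.det)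
    (w : E n) (hgap : GapCondition (lattice A) w)
    (D lam₁ : ℝ) (hD : D = |A.det|) (hlam₁ : lam₁ = 4 * π ^ 2 * ‖w‖ ^ 2)
    (φ u₁ c : E n → ℝ) (hφ : φ = uSin A w) (hu₁ : u₁ = uSin A w)
    (hc : c = fun x => Real.cos (4 * π * ⟪w, x⟫_ℝ))
    (S₁ : E n → ℝ)
    (hS₁ : S₁ = fun x =>
      lam₁ * (φ x) ^ 2 * u₁ x
      + (8 * lam₁ / (3 * D)) * φ x * c x
      + ((n : ℝ) - 2) * φ x * ⟪gradient φ x, gradient u₁ x⟫_ℝ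
      - (((n : ℝ) - 2) / (3 * lam₁)) *
          (4 * lam₁ * φ x * ((lam₁ / D) * c x)
            + lam₁ * ⟪gradient φ x, gradient (fun y => -c y / D) x⟫_ℝ)
      - (((n : ℝ) - 2) ^ 2 / (6 * lam₁)) *
          ⟪gradient φ x, gradient (fun y => (lam₁ / D) * c y) x⟫_ℝ) :
    ∀ x : E n, S₁ x =
      (lam₁ * ((n : ℝ) ^ 2 + (n : ℝ) - 5) / (6 * D)) * u₁ x
      + (Real.sqrt 2 * lam₁ * ((n : ℝ) ^ 2 - 7 * (n : ℝ) + 15) / (6 * D ^ ((3 : ℝ) / 2))) *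
          Real.sin (6 * π * ⟪w, x⟫_ℝ) := by
  intro x
  have hDpos : 0 < D := hD ▸ abs_pos.mpr hA.ne_zero
  have hwpos : 0 < ‖w‖ := norm_pos_iff.mpr hgap.2.1
  have hlam_pos : 0 < lam₁ := by rw [hlam₁]; positivity
  have hDpow : D ^ ((3 : ℝ) / 2) = D * √D := by
    rw [show (3 : ℝ) / 2 = 1 + 1 / 2 by norm_num, Real.rpow_add hDpos, Real.rpow_one,
      Real.sqrt_eq_rpow]
  have hu : uSin A w = fun y => √2 / √D * Real.sin (2 * π * ⟪w, y⟫_ℝ) := by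
    rw [hD]; rfl
  have hcneg : (fun y => -c y / D) = fun y => -1 / D * Real.cos (4 * π * ⟪w, y⟫_ℝ) := by
    rw [hc]; ext y; ring
  have hcmul : (fun y => lam₁ / D * c y) =
      fun y => lam₁ / D * Real.cos (4 * π * ⟪w, y⟫_ℝ) := by
    rw [hc]
  rw [hS₁, hcneg, hcmul, hφ, hu₁, hc, hu, hDpow]
  have hinner (α β : ℝ) : ⟪α • w, β • w⟫_ℝ = α * β * ‖w‖ ^ 2 := by
    rw [real_inner_smul_left, real_inner_smul_right, real_inner_self_eq_norm_sq, mul_assoc]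
  simp only [gradient_const_mul_sin_inner, gradient_const_mul_cos_inner, hinner]
  rw [show 4 * π * ⟪w, x⟫_ℝ = 2 * (2 * π * ⟪w, x⟫_ℝ) by ring,
    show 6 * π * ⟪w, x⟫_ℝ = 3 * (2 * π * ⟪w, x⟫_ℝ) by ring,
    Real.sin_three_mul, Real.sin_two_mul, Real.cos_two_mul]
  have hsc := Real.cos_sq' (2 * π * ⟪w, x⟫_ℝ)
  generalize Real.sin (2 * π * ⟪w, x⟫_ℝ) = s at *
  generalize Real.cos (2 * π * ⟪w, x⟫_ℝ) = C at *
  have ha : (√2 / √D) ^ 2 = 2 / D := by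
    rw [div_pow, Real.sq_sqrt zero_le_two, Real.sq_sqrt hDpos.le]
  have hcoef : √2 * lam₁ * ((n : ℝ) ^ 2 - 7 * n + 15) / (6 * (D * √D)) =
      √2 / √D * (lam₁ * ((n : ℝ) ^ 2 - 7 * n + 15) / (6 * D)) := by
    field_simp
  rw [hcoef]
  generalize √2 / √D = a at *
  have hw : π ^ 2 * ‖w‖ ^ 2 = lam₁ / 4 := by rw [hlam₁]; ring
  have hgrad : a * (2 * π) * C * (a * (2 * π) * C) * ‖w‖ ^ 2 = 2 / D * lam₁ * (1 - s ^ 2) := by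
    linear_combination 4 * a ^ 2 * C ^ 2 * hw + lam₁ * C ^ 2 * ha + 2 / D * lam₁ * hsc
  have hcross (k : ℝ) : a * (2 * π) * C * -(k * (4 * π) * (2 * s * C)) * ‖w‖ ^ 2 =
      -(4 * k * a * lam₁ * s * (1 - s ^ 2)) := by
    linear_combination -16 * a * k * s * C ^ 2 * hw - 4 * k * a * lam₁ * s * hsc
  have hcube : (a * s) ^ 2 = 2 / D * s ^ 2 := by rw [mul_pow, ha]
  rw [hcube]
  simp only [hgrad, hcross, hsc]
  field_simp
  ring
end
end
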